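/- Let α ∈ (1,2), σ = 1 - α/2, τ > 0, and let k ≥ 2 be an integer. Then the sequence a_l^{(k,α)} is strictly increasing in l: a_l^{(k,α)} < a_{l+1}^{(k,α)} for every 1 ≤ l ≤ k - 1. -/

import Mathlib

open MeasureTheory Finset

/-- `a_l^{(k,α)}` from the H3N3-2σ construction. -/
noncomputable def aCoef (α σ τ : ℝ) (k l : ℕ) : ℝ :=
  if l = 1 then
    (3/2) * τ ^ (2 - α) * ∫ s in (0:ℝ)..(1/2), (s - 1/3) * ((k : ℝ) + σ - s) ^ (1 - α)
  else
    τ ^ (2 - α) * ∫ s in (0:ℝ)..1, (s - 1/2) * ((k : ℝ) + σ - (l : ℝ) + 3/2 - s) ^ (1 - α)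

/-- `b_l^{(k,α)}` from the H3N3-2σ construction. -/
noncomputable def bCoef (α σ τ : ℝ) (k l : ℕ) : ℝ :=
  if l = k then
    τ ^ (2 - α) * ∫ s in (0:ℝ)..(σ + 1/2), s ^ (1 - α)
  else
    τ ^ (2 - α) * ∫ s in (0:ℝ)..1, (3/2 - s) * ((k : ℝ) + σ - (l : ℝ) + 1/2 - s) ^ (1 - α)

/-- `c_l^{(k,α)}`, the H3N3-2σ coefficients. -/
noncomputable def cCoef (α σ τ : ℝ) (k l : ℕ) : ℝ :=
  if l = k then
    (3/2) * τ ^ (2 - α) * ∫ s in (0:ℝ)..(1/2), (1 - s) * ((k : ℝ) + σ - s) ^ (1 - α)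
  else
    aCoef α σ τ k (k - l) + bCoef α σ τ k (k - l)

/-- A continuous strictly increasing function has positive first moment about the midpoint. -/
theorem integral_sub_half_mul_pos {h : ℝ → ℝ} (hc : ContinuousOn h (Set.Icc 0 1))
    (hm : StrictMonoOn h (Set.Icc 0 1)) : 0 < ∫ s in (0:ℝ)..1, (s - 1/2) * h s := by
  have hhalf : (1/2 : ℝ) ∈ Set.Icc (0:ℝ) 1 := by norm_num
  have hzero : ∫ s in (0:ℝ)..1, (s - 1/2) * h (1/2) = 0 := by
    rw [intervalIntegral.integral_mul_const, intervalIntegral.integral_sub (by simp) (by simp)]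
    norm_num
  refine hzero.symm.trans_lt <|
    intervalIntegral.integral_lt_integral_of_continuousOn_of_le_of_exists_lt
    zero_lt_one ?_ ?_ (fun s hs => ?_) ⟨1, by norm_num, ?_⟩
  · fun_prop
  · fun_prop
  · rcases le_total s (1/2) with hle | hle
    · exact mul_le_mul_of_nonpos_left
        (hm.monotoneOn ⟨hs.1.le, hs.2⟩ hhalf hle) (by linarith)
    · exact mul_le_mul_of_nonneg_left
        (hm.monotoneOn hhalf ⟨hs.1.le, hs.2⟩ hle) (by linarith)
  · exact mul_lt_mul_of_pos_left (hm hhalf (by norm_num) (by norm_num)) (by norm_num)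

theorem strictAntiOn_rpow_sub_rpow_add_one {p : ℝ} (hp : p < 0) :
    StrictAntiOn (fun y : ℝ => y ^ p - (y + 1) ^ p) (Set.Ioi 0) := by
  have hderiv : ∀ y ∈ Set.Ioi (0:ℝ), HasDerivAt (fun y : ℝ => y ^ p - (y + 1) ^ p)
      (p * y ^ (p - 1) - p * (y + 1) ^ (p - 1)) y := by
    intro y hy
    have hy : 0 < y := hy
    have h₂ := ((hasDerivAt_id y).add_const 1).rpow_const (p := p)
      (Or.inl (by simp only [id]; positivity))
    exact ((Real.hasDerivAt_rpow_const (Or.inl hy.ne')).sub h₂).congr_deriv (by simp)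
  refine strictAntiOn_of_deriv_neg (convex_Ioi 0)
    (fun y hy => (hderiv y hy).continuousAt.continuousWithinAt) fun y hy => ?_
  rw [interior_Ioi] at hy
  rw [(hderiv y hy).deriv]
  have hlt : (y + 1) ^ (p - 1) < y ^ (p - 1) :=
    Real.rpow_lt_rpow_of_neg hy (by linarith) (by linarith)
  nlinarith

theorem continuousOn_sub_rpow {X a b : ℝ} (p : ℝ) (hX : b < X) :
    ContinuousOn (fun s : ℝ => (X - s) ^ p) (Set.Icc a b) :=
  ContinuousOn.rpow_const (by fun_prop) fun s hs => Or.inl (by linarith [hs.2])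

/-- The step `M ↦ M - 1` strictly increases the first moment of `s ↦ (M - s) ^ p`
about the midpoint. -/
theorem integral_sub_half_mul_rpow_lt {p M : ℝ} (hp : p < 0) (hM : 2 < M) :
    ∫ s in (0:ℝ)..1, (s - 1/2) * (M - s) ^ p <
      ∫ s in (0:ℝ)..1, (s - 1/2) * (M - 1 - s) ^ p := by
  have hc₀ := continuousOn_sub_rpow (X := M) (a := 0) (b := 1) p (by linarith)
  have hc₁ := continuousOn_sub_rpow (X := M - 1) (a := 0) (b := 1) p (by linarith)
  have hpos := integral_sub_half_mul_pos (hc₁.sub hc₀) fun s hs t ht hst => by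
    have := strictAntiOn_rpow_sub_rpow_add_one hp (a := M - 1 - t) (b := M - 1 - s)
      (by simp only [Set.mem_Ioi]; linarith [ht.2])
      (by simp only [Set.mem_Ioi]; linarith [hs.2]) (by linarith)
    simpa [show M - 1 - t + 1 = M - t by ring, show M - 1 - s + 1 = M - s by ring] using this
  rw [← sub_pos, ← intervalIntegral.integral_sub]
  · simpa [mul_sub] using hpos
  all_goals
    refine ContinuousOn.intervalIntegrable ?_
    rw [Set.uIcc_of_le zero_le_one]
    fun_prop

theorem integral_sub_half_mul_rpow_pos {p M : ℝ} (hp : p < 0) (hM : 1 < M) :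
    0 < ∫ s in (0:ℝ)..1, (s - 1/2) * (M - s) ^ p :=
  integral_sub_half_mul_pos (continuousOn_sub_rpow p hM) fun s _ t ht hst =>
    Real.rpow_lt_rpow_of_neg (by linarith [ht.2]) (by linarith) hp

theorem integral_sub_third_mul_rpow_neg {p X : ℝ} (hp₀ : p < 0) (hp₁ : -1 < p) (hX : 2 ≤ X) :
    ∫ s in (0:ℝ)..(1/2), (s - 1/3) * (X - s) ^ p < 0 := by
  have hXpos : 0 < X ^ p := by positivity
  have hbound : ∀ s ∈ Set.Icc (0:ℝ) (1/2),
      (s - 1/3) * (X - s) ^ p ≤ ((s - 1/3) + 1/18) * X ^ p := by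
    intro s hs
    have hs₀ := hs.1
    have hs₁ := hs.2
    have hlower : X ^ p ≤ (X - s) ^ p :=
      Real.rpow_le_rpow_of_nonpos (by linarith) (by linarith) hp₀.le
    have hupper : (X - s) ^ p ≤ 4/3 * X ^ p := by
      calc (X - s) ^ p ≤ (3/4 * X) ^ p :=
            Real.rpow_le_rpow_of_nonpos (by linarith) (by linarith) hp₀.le
        _ = (3/4 : ℝ) ^ p * X ^ p := Real.mul_rpow (by norm_num) (by linarith)
        _ ≤ (3/4 : ℝ) ^ (-1 : ℝ) * X ^ p := by
            gcongr ?_ * _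
            exact Real.rpow_le_rpow_of_exponent_ge (by norm_num) (by norm_num) hp₁.le
        _ = 4/3 * X ^ p := by rw [Real.rpow_neg_one]; norm_num
    nlinarith [mul_nonneg (sub_nonneg.2 hlower) (sub_nonneg.2 hs₁)]
  have hle : ∫ s in (0:ℝ)..(1/2), (s - 1/3) * (X - s) ^ p ≤
      ∫ s in (0:ℝ)..(1/2), ((s - 1/3) + 1/18) * X ^ p := by
    refine intervalIntegral.integral_mono_on (by norm_num) ?_
      (Continuous.intervalIntegrable (by fun_prop) _ _) hbound
    refine ContinuousOn.intervalIntegrable ?_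
    rw [Set.uIcc_of_le (by norm_num)]
    have := continuousOn_sub_rpow (X := X) (a := 0) (b := 1/2) p (by linarith)
    fun_prop
  have hval : ∫ s in (0:ℝ)..(1/2), ((s - 1/3 : ℝ) + 1/18) = -1/72 := by
    rw [intervalIntegral.integral_add (by simp) (by simp),
      intervalIntegral.integral_sub (by simp) (by simp)]
    norm_num
  rw [intervalIntegral.integral_mul_const, hval] at hle
  linarith

/-- The sequence `a_l^{(k,α)}` is strictly increasing in `l` for `1 ≤ l ≤ k-1`,
with `σ = 1 - α/2`. -/
theorem aCoef_strict_increasing (α τ : ℝ) (hα1 : 1 < α) (hα2 : α < 2)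
    (hτ : 0 < τ) (k : ℕ) (hk : 2 ≤ k) :
    ∀ l, 1 ≤ l → l ≤ k - 1 →
      aCoef α (1 - α/2) τ k l < aCoef α (1 - α/2) τ k (l+1) := by
  intro l hl hlk
  have hτp : 0 < τ ^ (2 - α) := by positivity
  have hp : 1 - α < 0 := by linarith
  have hk' : (2:ℝ) ≤ k := by exact_mod_cast hk
  rcases eq_or_ne l 1 with rfl | hl1
  · have hneg := integral_sub_third_mul_rpow_neg hp (by linarith)
      (X := (k : ℝ) + (1 - α/2)) (by linarith)
    have hpos := integral_sub_half_mul_rpow_pos hp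
      (M := (k : ℝ) + (1 - α/2) - ((1 + 1 : ℕ) : ℝ) + 3/2) (by push_cast; linarith)
    rw [aCoef, aCoef, if_pos rfl, if_neg (by norm_num)]
    exact (mul_neg_of_pos_of_neg (by positivity) hneg).trans (mul_pos hτp hpos)
  · have hlk' : (l : ℝ) + 1 ≤ k := by exact_mod_cast (by omega : l + 1 ≤ k)
    have hlt := integral_sub_half_mul_rpow_lt hp
      (M := (k : ℝ) + (1 - α/2) - (l : ℝ) + 3/2) (by linarith)
    rw [aCoef, aCoef, if_neg hl1, if_neg (by omega)]
    have hshift : (k : ℝ) + (1 - α/2) - ((l + 1 : ℕ) : ℝ) + 3/2 =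
        (k : ℝ) + (1 - α/2) - (l : ℝ) + 3/2 - 1 := by push_cast; ring
    rw [hshift]
    exact mul_lt_mul_of_pos_left hlt hτp
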